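/- arXiv:1611.04807 — 2 statements merged into one kernel-verified Lean document; each statement's English description precedes it below -/
import Mathlib

section
/- (Faà di Bruno's formula) If u and v are sufficiently smooth functions, then the l-th derivative of the composition satisfies d^l/dt^l u(v(t)) = Σ_{S_l} l!/(b₁! b₂! 2!^{b₂} ⋯ b_l! l!^{b_l}) · u^{(L)}(v(t)) applied to the product ⨀_{j=1}^l (v^{(j)}(t))^{b_j}, where S_l is the set of all l-tuples of nonnegative integers (b₁,…,b_l) with b₁ + 2b₂ + ⋯ + l·b_l = l and L = b₁ + ⋯ + b_l. -/
open scoped Nat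

/-- Given block sizes `b 0, b 1, …, b (l-1)`, `blockIndex l b i` is the index `j`
of the block containing position `i`, i.e. the least `j` with
`i < b 0 + ⋯ + b j` (counting convention). -/
def blockIndex (l : ℕ) (b : ℕ → ℕ) (i : ℕ) : ℕ :=
  ((Finset.range l).filter fun j => (∑ j' ∈ Finset.range (j + 1), b j') ≤ i).card

section Symmetry

variable {E F : Type*} [NormedAddCommGroup E] [NormedSpace ℝ E]
  [NormedAddCommGroup F] [NormedSpace ℝ F]

theorem iteratedFDeriv_succ_apply_eq_fderiv {n : ℕ} {f : E → F} {x : E}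
    (h : DifferentiableAt ℝ (iteratedFDeriv ℝ n f) x) (m : Fin (n + 1) → E) :
    iteratedFDeriv ℝ (n + 1) f x m =
      fderiv ℝ (fun y => iteratedFDeriv ℝ n f y (Fin.tail m)) x (m 0) := by
  rw [iteratedFDeriv_succ_apply_left]
  have := (ContinuousMultilinearMap.apply ℝ (fun _ : Fin n => E) F
    (Fin.tail m)).hasFDerivAt.comp x h.hasFDerivAt
  exact (congrArg (fun L => L (m 0)) this.fderiv).symm

theorem iteratedFDeriv_comp_swap {f : E → F} : ∀ {n : ℕ} (_ : ContDiff ℝ (n + 1 : ℕ) f) (x : E)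
    (m : Fin (n + 1) → E) (i : Fin n),
    iteratedFDeriv ℝ (n + 1) f x (m ∘ Equiv.swap i.castSucc i.succ) =
      iteratedFDeriv ℝ (n + 1) f x m
  | 0, _, _, _, i => i.elim0
  | n + 1, hf, x, m, i => by
    have hd : Differentiable ℝ (iteratedFDeriv ℝ (n + 1) f) :=
      hf.differentiable_iteratedFDeriv (by exact_mod_cast Nat.lt_succ_self _)
    rw [iteratedFDeriv_succ_apply_eq_fderiv (hd x), iteratedFDeriv_succ_apply_eq_fderiv (hd x)]
    induction i using Fin.cases with
    | zero =>
      have hc : ContDiff ℝ 2 (iteratedFDeriv ℝ n f) :=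
        hf.iteratedFDeriv_right (by norm_cast; omega)
      have hd' : Differentiable ℝ (iteratedFDeriv ℝ n f) := hc.differentiable (by norm_num)
      have hdd : Differentiable ℝ (fderiv ℝ (iteratedFDeriv ℝ n f)) :=
        (hc.fderiv_right (m := 1) (by norm_num)).differentiable (by norm_num)
      have key (w : Fin (n + 1) → E) (e : E) :
          fderiv ℝ (fun y => iteratedFDeriv ℝ (n + 1) f y w) x e =
            fderiv ℝ (fderiv ℝ (iteratedFDeriv ℝ n f)) x e (w 0) (Fin.tail w) := by
        simp only [iteratedFDeriv_succ_apply_left]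
        have h1 := (hdd x).hasFDerivAt.clm_apply (hasFDerivAt_const (w 0) x)
        have h2 := (ContinuousMultilinearMap.apply ℝ (fun _ : Fin n => E) F
          (Fin.tail w)).hasFDerivAt.comp x h1
        have := congrArg (fun L => L e) h2.fderiv
        simpa [Function.comp_def] using this
      rw [key, key, (hc.contDiffAt.isSymmSndFDerivAt (by simp)).eq]
      have h0 : Fin.tail (Fin.tail (m ∘ Equiv.swap (0 : Fin (n + 1)).castSucc (Fin.succ 0))) =
          Fin.tail (Fin.tail m) := by
        funext j
        simp only [Fin.tail, Function.comp_apply]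
        rw [Equiv.swap_apply_of_ne_of_ne] <;> simp [Fin.ext_iff]
      rw [h0]
      simp [Fin.tail]
    | succ i =>
      have h0 : (m ∘ Equiv.swap i.succ.castSucc i.succ.succ) 0 = m 0 := by
        simp only [Function.comp_apply]
        rw [Equiv.swap_apply_of_ne_of_ne] <;> simp [Fin.ext_iff]
      have ht : Fin.tail (m ∘ Equiv.swap i.succ.castSucc i.succ.succ) =
          Fin.tail m ∘ Equiv.swap i.castSucc i.succ := by
        funext j
        simp only [Fin.tail, Function.comp_apply, ← Fin.succ_castSucc]
        rw [← (Fin.succ_injective _).map_swap]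
      rw [h0, ht]
      simp only [iteratedFDeriv_comp_swap (hf.of_le (by norm_cast; omega)) _ (Fin.tail m) i]

/-- The `n`-th iterated derivative of a `C^n` function is symmetric. -/
theorem ContDiff.iteratedFDeriv_comp_perm {n : ℕ} {f : E → F} (hf : ContDiff ℝ n f) (x : E)
    (m : Fin n → E) (σ : Equiv.Perm (Fin n)) :
    iteratedFDeriv ℝ n f x (m ∘ σ) = iteratedFDeriv ℝ n f x m := by
  cases n with
  | zero => exact congrArg _ (Subsingleton.elim _ _)
  | succ n =>
    have hσ : σ ∈ Submonoid.closure
        (Set.range fun i : Fin n => Equiv.swap i.castSucc i.succ) := by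
      rw [Equiv.Perm.mclosure_swap_castSucc_succ]; trivial
    induction hσ using Submonoid.closure_induction generalizing m with
    | mem σ hσ =>
      obtain ⟨i, rfl⟩ := hσ
      exact iteratedFDeriv_comp_swap hf x m i
    | one => rfl
    | mul σ τ _ _ hσ hτ => rw [Equiv.Perm.coe_mul, ← Function.comp_assoc, hτ, hσ]

/-- If two families of indices agree as multisets, so do the values of the iterated derivative
of a smooth function at the corresponding vectors. -/
theorem ContDiff.iteratedFDeriv_apply_eq_of_map_eq {l n k : ℕ} {f : E → F}
    (hf : ContDiff ℝ l f) (hn : n ≤ l) (x : E) (w : ℕ → E) {a : Fin n → ℕ} {b : Fin k → ℕ}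
    (h : Finset.univ.val.map a = Finset.univ.val.map b) :
    iteratedFDeriv ℝ n f x (fun i => w (a i)) = iteratedFDeriv ℝ k f x (fun i => w (b i)) := by
  obtain rfl : n = k := by simpa using congrArg Multiset.card h
  have hcard (y : ℕ) : Nonempty ({i // a i = y} ≃ {i // b i = y}) := by
    rw [← Fintype.card_eq, Fintype.card_subtype, Fintype.card_subtype]
    have := congrArg (Multiset.count y) h
    simpa only [Multiset.count_map, Finset.card_def, Finset.filter_val, eq_comm] using this
  let σ : Equiv.Perm (Fin n) := Equiv.ofFiberEquiv fun y => (hcard y).some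
  have hσ (i : Fin n) : b (σ i) = a i := Equiv.ofFiberEquiv_map _ i
  simp only [← hσ]
  exact (hf.of_le (by exact_mod_cast hn)).iteratedFDeriv_comp_perm x (fun i => w (b i)) σ

end Symmetry

/-- The product of the factorials of the elements of `m` and of the multiplicities in `m`. -/
def Multiset.factorialWeight (m : Multiset ℕ) : ℕ :=
  (m.map (· !)).prod * ∏ j ∈ m.toFinset, (m.count j)!

theorem Multiset.factorialWeight_eq_of_subset {m : Multiset ℕ} {s : Finset ℕ}
    (hs : m.toFinset ⊆ s) :
    m.factorialWeight = ∏ j ∈ s, ((m.count j)! * j ! ^ m.count j) := by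
  rw [factorialWeight, Finset.prod_multiset_map_count, ← Finset.prod_mul_distrib]
  refine Finset.prod_subset_one_on_sdiff hs (fun j hj => ?_) fun j _ => mul_comm _ _
  have : m.count j = 0 :=
    Multiset.count_eq_zero_of_notMem (by simpa using (Finset.mem_sdiff.1 hj).2)
  simp [this]

theorem Multiset.factorialWeight_cons (a : ℕ) (m : Multiset ℕ) :
    (a ::ₘ m).factorialWeight = m.factorialWeight * a ! * (m.count a + 1) := by
  have ha : a ∈ (a ::ₘ m).toFinset := by simp
  rw [factorialWeight_eq_of_subset (m := m) (s := (a ::ₘ m).toFinset)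
      (by rw [Multiset.toFinset_cons]; exact Finset.subset_insert _ _),
    factorialWeight_eq_of_subset subset_rfl, ← Finset.mul_prod_erase _ _ ha,
    ← Finset.mul_prod_erase _ _ ha]
  have : ∀ j ∈ (a ::ₘ m).toFinset.erase a,
      ((a ::ₘ m).count j)! * j ! ^ (a ::ₘ m).count j = (m.count j)! * j ! ^ m.count j := by
    intro j hj
    rw [Multiset.count_cons_of_ne (Finset.ne_of_mem_erase hj)]
  rw [Finset.prod_congr rfl this, Multiset.count_cons_self, Nat.factorial_succ, pow_succ]
  ring

namespace OrderedFinpartition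

variable {n : ℕ}

/-- The multiset of the sizes of the parts of an ordered finpartition. -/
def partSizes (c : OrderedFinpartition n) : Multiset ℕ := Finset.univ.val.map c.partSize

theorem sum_partSizes (c : OrderedFinpartition n) : c.partSizes.sum = n := by
  have h : ∑ m, ∑ _r : Fin (c.partSize m), 1 = ∑ _i : Fin n, 1 := c.sum_sigma_eq_sum fun _ => 1
  simp only [Finset.sum_const, Finset.card_univ, Fintype.card_fin, smul_eq_mul, mul_one] at h
  exact h

theorem pos_of_mem_partSizes {c : OrderedFinpartition n} {x : ℕ} (h : x ∈ c.partSizes) :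
    0 < x := by
  obtain ⟨i, -, rfl⟩ := Multiset.mem_map.1 h
  exact c.partSize_pos i

theorem zero_notMem_partSizes (c : OrderedFinpartition n) : 0 ∉ c.partSizes :=
  fun h => (pos_of_mem_partSizes h).false

theorem le_of_mem_partSizes {c : OrderedFinpartition n} {x : ℕ} (h : x ∈ c.partSizes) :
    x ≤ n := c.sum_partSizes ▸ Multiset.single_le_sum (fun _ _ => Nat.zero_le _) _ h

theorem partSizes_extendLeft (c : OrderedFinpartition n) :
    c.extendLeft.partSizes = 1 ::ₘ c.partSizes := by
  simp only [partSizes, extendLeft_partSize]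
  change Multiset.map (Fin.cons 1 c.partSize) (Finset.univ : Finset (Fin (c.length + 1))).val = _
  rw [Fin.univ_succ]
  simp [Function.comp_def]

theorem partSizes_extendMiddle (c : OrderedFinpartition n) (k : Fin c.length) :
    (c.extendMiddle k).partSizes =
      (c.partSize k + 1) ::ₘ c.partSizes.erase (c.partSize k) := by
  simp only [partSizes, extendMiddle_partSize]
  change Multiset.map (Function.update c.partSize k (c.partSize k + 1))
    (Finset.univ : Finset (Fin c.length)).val = _
  have hk : k ∈ (Finset.univ : Finset (Fin c.length)).val := Finset.mem_univ k
  have hnd : (Finset.univ : Finset (Fin c.length)).val.Nodup := Finset.univ.nodup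
  rw [← Multiset.map_erase_of_mem _ _ hk]
  conv_lhs => rw [← Multiset.cons_erase hk]
  rw [Multiset.map_cons, Function.update_self]
  congr 1
  refine Multiset.map_congr rfl fun j hj => ?_
  rw [Function.update_of_ne]
  exact (hnd.mem_erase_iff.1 hj).1

/-- The number of ordered finpartitions whose part sizes form the multiset `m`. -/
noncomputable def countPartSizes (n : ℕ) (m : Multiset ℕ) : ℕ :=
  ∑ c : OrderedFinpartition n, if c.partSizes = m then 1 else 0

theorem countPartSizes_succ (n : ℕ) (m : Multiset ℕ) :
    countPartSizes (n + 1) m =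
      (∑ c : OrderedFinpartition n, if 1 ::ₘ c.partSizes = m then 1 else 0) +
      ∑ x ∈ Finset.range (n + 1), ∑ c : OrderedFinpartition n,
        c.partSizes.count x * if (x + 1) ::ₘ c.partSizes.erase x = m then 1 else 0 := by
  rw [countPartSizes, ← (extendEquiv n).sum_comp, Fintype.sum_sigma, Finset.sum_comm,
    ← Finset.sum_add_distrib]
  refine Finset.sum_congr rfl fun c _ => ?_
  simp only [extendEquiv_apply, Fintype.sum_option, extend_none, extend_some,
    partSizes_extendLeft, partSizes_extendMiddle]
  congr 1
  let F : ℕ → ℕ := fun x => if (x + 1) ::ₘ c.partSizes.erase x = m then 1 else 0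
  have hsub : c.partSizes.toFinset ⊆ Finset.range (n + 1) := fun x hx => by
    simpa [Nat.lt_succ_iff] using le_of_mem_partSizes (Multiset.mem_toFinset.1 hx)
  calc ∑ k, F (c.partSize k) = (c.partSizes.map F).sum := by
        rw [partSizes, Multiset.map_map]; rfl
    _ = ∑ x ∈ c.partSizes.toFinset, c.partSizes.count x * F x := by
        simp [Finset.sum_multiset_map_count]
    _ = _ := Finset.sum_subset hsub fun x _ hx => by
        rw [Multiset.count_eq_zero_of_notMem (by simpa using hx), zero_mul]

theorem countPartSizes_mul_factorialWeight (n : ℕ) : ∀ (m : Multiset ℕ), m.sum = n → 0 ∉ m →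
    countPartSizes n m * m.factorialWeight = n ! := by
  induction n with
  | zero =>
    intro m hs h0
    have hm : m = 0 := Multiset.eq_zero_of_forall_notMem fun x hx => by
      have := Multiset.single_le_sum (fun _ _ => Nat.zero_le _) _ hx
      obtain rfl : x = 0 := by omega
      exact h0 hx
    subst hm
    have (c : OrderedFinpartition 0) : c.partSizes = 0 :=
      Multiset.eq_zero_of_forall_notMem fun x hx =>
        (pos_of_mem_partSizes hx).not_ge (le_of_mem_partSizes hx)
    simp [countPartSizes, this, Multiset.factorialWeight]
  | succ n ih =>
    intro m hs h0
    have hleft : (∑ c : OrderedFinpartition n, if 1 ::ₘ c.partSizes = m then 1 else 0) *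
        m.factorialWeight = n ! * (1 * m.count 1) := by
      by_cases h1 : 1 ∈ m
      · obtain ⟨r, rfl⟩ := Multiset.exists_cons_of_mem h1
        have := ih r (by simpa [add_comm] using hs) (by simpa using h0)
        simp only [Multiset.cons_inj_right, Multiset.factorialWeight_cons,
          Multiset.count_cons_self, ← this, countPartSizes]
        simp
        ring
      · have (c : OrderedFinpartition n) : 1 ::ₘ c.partSizes ≠ m := by
          rintro rfl; simp at h1
        simp [this, Multiset.count_eq_zero_of_notMem h1]
    have hmid (x : ℕ) (hx : x ≠ 0) : (∑ c : OrderedFinpartition n,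
        c.partSizes.count x * if (x + 1) ::ₘ c.partSizes.erase x = m then 1 else 0) *
        m.factorialWeight = n ! * ((x + 1) * m.count (x + 1)) := by
      by_cases h1 : x + 1 ∈ m
      · obtain ⟨r, rfl⟩ := Multiset.exists_cons_of_mem h1
        have h := ih (x ::ₘ r) (by simp at hs ⊢; omega) (by simp at h0 ⊢; tauto)
        have hc (c : OrderedFinpartition n) :
            (c.partSizes.count x * if (x + 1) ::ₘ c.partSizes.erase x = (x + 1) ::ₘ r
              then 1 else 0) = (r.count x + 1) * if c.partSizes = x ::ₘ r then 1 else 0 := by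
          by_cases hxc : x ∈ c.partSizes
          · obtain ⟨s, hs⟩ := Multiset.exists_cons_of_mem hxc
            simp only [hs, Multiset.erase_cons_head, Multiset.cons_inj_right,
              Multiset.count_cons_self]
            split_ifs with h
            · rw [h]
            · simp
          · have : c.partSizes ≠ x ::ₘ r := by
              intro h; simp [h] at hxc
            simp [Multiset.count_eq_zero_of_notMem hxc, this]
        simp only [hc, ← Finset.mul_sum]
        rw [← h, countPartSizes, Multiset.factorialWeight_cons, Multiset.factorialWeight_cons,
          Multiset.count_cons_self, Nat.factorial_succ]
        ring
      · have (c : OrderedFinpartition n) : (x + 1) ::ₘ c.partSizes.erase x ≠ m := by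
          rintro rfl; simp at h1
        simp [this, Multiset.count_eq_zero_of_notMem h1]
    have hsub : m.toFinset ⊆ Finset.range (n + 2) := fun x hx => by
      have := Multiset.single_le_sum (fun _ _ => Nat.zero_le _) _ (Multiset.mem_toFinset.1 hx)
      simp; omega
    have hsum := Finset.sum_multiset_count_of_subset m _ hsub
    simp only [smul_eq_mul] at hsum
    rw [hs, Finset.sum_range_succ', Finset.sum_range_succ'] at hsum
    rw [countPartSizes_succ, Finset.sum_range_succ', add_mul, add_mul, hleft, Finset.sum_mul,
      Finset.sum_congr rfl fun x _ => hmid (x + 1) x.succ_ne_zero, Nat.factorial_succ, hsum,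
      ← Finset.mul_sum]
    simp only [Multiset.count_eq_zero_of_notMem (zero_notMem_partSizes _)]
    simp [mul_comm, mul_add]
    ring

end OrderedFinpartition

theorem blockIndex_succ_of_lt {l : ℕ} {b : ℕ → ℕ} {i : ℕ} (h : i < ∑ j ∈ Finset.range l, b j) :
    blockIndex (l + 1) b i = blockIndex l b i := by
  rw [blockIndex, blockIndex, Finset.range_add_one, Finset.filter_insert, if_neg]
  rw [not_le, Finset.sum_range_succ]
  omega

theorem blockIndex_succ_of_mem {l : ℕ} {b : ℕ → ℕ} {i : ℕ} (h : i < b l) :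
    blockIndex (l + 1) b ((∑ j ∈ Finset.range l, b j) + i) = l := by
  rw [blockIndex, Finset.range_add_one, Finset.filter_insert, if_neg, Finset.filter_true_of_mem,
    Finset.card_range]
  · intro j hj
    exact (Finset.sum_le_sum_of_subset (Finset.range_subset_range.2 (Finset.mem_range.1 hj))).trans
      (Nat.le_add_right _ _)
  · rw [Finset.sum_range_succ]
    omega

theorem map_blockIndex_range (l : ℕ) (b : ℕ → ℕ) :
    (Multiset.range (∑ j ∈ Finset.range l, b j)).map (blockIndex l b) =
      ∑ j ∈ Finset.range l, Multiset.replicate (b j) j := by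
  induction l with
  | zero => simp
  | succ l ih =>
    rw [Finset.sum_range_succ, Finset.sum_range_succ, Multiset.range_add, Multiset.map_add,
      Multiset.map_map, ← ih]
    congr 1
    · exact Multiset.map_congr rfl fun i hi => blockIndex_succ_of_lt (Multiset.mem_range.1 hi)
    · rw [Multiset.eq_replicate]
      refine ⟨by simp, fun j hj => ?_⟩
      obtain ⟨i, hi, rfl⟩ := Multiset.mem_map.1 hj
      exact blockIndex_succ_of_mem (Multiset.mem_range.1 hi)

/-- The multiset containing `j + 1` with multiplicity `b j`. -/
def multisetOfMultiplicities {l : ℕ} (b : Fin l → ℕ) : Multiset ℕ :=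
  ∑ j, Multiset.replicate (b j) ((j : ℕ) + 1)

section multisetOfMultiplicities

variable {l : ℕ} (b : Fin l → ℕ)

theorem map_blockIndex_univ :
    (Finset.univ : Finset (Fin (∑ j, b j))).val.map
      (fun i : Fin (∑ j, b j) =>
        blockIndex l (fun j => if h : j < l then b ⟨j, h⟩ else 0) (i : ℕ) + 1) =
    multisetOfMultiplicities b := by
  set B : ℕ → ℕ := fun j => if h : j < l then b ⟨j, h⟩ else 0 with hB
  have hb (j : Fin l) : b j = B j := by simp [hB]
  have hsum : ∑ j, b j = ∑ j ∈ Finset.range l, B j := by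
    simp only [hb, Finset.sum_range]
  have hr (N : ℕ) (f : ℕ → ℕ) :
      (Finset.univ : Finset (Fin N)).val.map (fun i : Fin N => f i) = (Multiset.range N).map f := by
    rw [← Finset.range_val, ← Nat.Iio_eq_range, ← Fin.map_valEmbedding_univ, Finset.map_val,
      Multiset.map_map]
    rfl
  rw [hr _ (fun i => blockIndex l B i + 1), hsum, multisetOfMultiplicities]
  have := congrArg (Multiset.map (· + 1)) (map_blockIndex_range l B)
  rw [Multiset.map_map] at this
  refine this.trans ?_
  rw [← Multiset.coe_mapAddMonoidHom, map_sum, Finset.sum_range]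
  simp [hb]

theorem count_multisetOfMultiplicities (j : Fin l) :
    (multisetOfMultiplicities b).count ((j : ℕ) + 1) = b j := by
  simp [multisetOfMultiplicities, Multiset.count_sum', Multiset.count_replicate, Fin.val_inj]

theorem sum_multisetOfMultiplicities :
    (multisetOfMultiplicities b).sum = ∑ j : Fin l, ((j : ℕ) + 1) * b j := by
  simp [multisetOfMultiplicities, Multiset.sum_sum, mul_comm]

theorem mem_multisetOfMultiplicities {x : ℕ} (h : x ∈ multisetOfMultiplicities b) :
    ∃ j : Fin l, x = j + 1 := by
  obtain ⟨j, -, hj⟩ := Multiset.mem_sum.1 h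
  exact ⟨j, Multiset.eq_of_mem_replicate hj⟩

theorem factorialWeight_multisetOfMultiplicities :
    (multisetOfMultiplicities b).factorialWeight =
      ∏ j : Fin l, ((b j)! * ((j : ℕ) + 1)! ^ b j) := by
  have hsub : (multisetOfMultiplicities b).toFinset ⊆
      Finset.univ.map ((Fin.valEmbedding (n := l)).trans (addRightEmbedding 1)) := by
    intro x hx
    obtain ⟨j, rfl⟩ := mem_multisetOfMultiplicities b (Multiset.mem_toFinset.1 hx)
    simp
  rw [Multiset.factorialWeight_eq_of_subset hsub, Finset.prod_map]
  simp [count_multisetOfMultiplicities]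

end multisetOfMultiplicities

namespace OrderedFinpartition

variable {l : ℕ}

/-- The number of parts of size `j + 1`, for `j < l`, of an ordered finpartition of `Fin l`. -/
def multiplicity (c : OrderedFinpartition l) (j : Fin l) : Fin (l + 1) :=
  ⟨c.partSizes.count ((j : ℕ) + 1), by
    rw [Nat.lt_succ_iff]
    refine (Multiset.count_le_card _ _).trans ?_
    simpa [partSizes] using c.length_le⟩

theorem multisetOfMultiplicities_multiplicity (c : OrderedFinpartition l) :
    multisetOfMultiplicities (fun j => (c.multiplicity j : ℕ)) = c.partSizes := by
  ext x
  by_cases hx : ∃ j : Fin l, x = j + 1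
  · obtain ⟨j, rfl⟩ := hx
    rw [count_multisetOfMultiplicities, multiplicity]
  · rw [Multiset.count_eq_zero_of_notMem fun h => hx (mem_multisetOfMultiplicities _ h),
      Multiset.count_eq_zero_of_notMem]
    intro h
    have h0 := pos_of_mem_partSizes h
    have h1 := le_of_mem_partSizes h
    exact hx ⟨⟨x - 1, by omega⟩, by simp; omega⟩

theorem multiplicity_eq_iff (c : OrderedFinpartition l) (b : Fin l → Fin (l + 1)) :
    c.multiplicity = b ↔ c.partSizes = multisetOfMultiplicities (fun j => (b j : ℕ)) := by
  constructor
  · rintro rfl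
    exact c.multisetOfMultiplicities_multiplicity.symm
  · intro h
    ext j
    simp [multiplicity, h, count_multisetOfMultiplicities]

theorem card_multiplicity_eq (b : Fin l → Fin (l + 1)) :
    (Finset.univ.filter fun c : OrderedFinpartition l => c.multiplicity = b).card =
      countPartSizes l (multisetOfMultiplicities fun j => (b j : ℕ)) := by
  simp only [multiplicity_eq_iff, Finset.card_filter, countPartSizes]

theorem sum_mul_multiplicity (c : OrderedFinpartition l) :
    ∑ j : Fin l, ((j : ℕ) + 1) * (c.multiplicity j : ℕ) = l := by
  rw [← sum_multisetOfMultiplicities, multisetOfMultiplicities_multiplicity, sum_partSizes]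

theorem card_multiplicity_eq_div (b : Fin l → Fin (l + 1))
    (hb : ∑ j : Fin l, ((j : ℕ) + 1) * (b j : ℕ) = l) :
    ((Finset.univ.filter fun c : OrderedFinpartition l => c.multiplicity = b).card : ℝ) =
      (l ! : ℝ) / ((∏ j : Fin l, ((b j : ℕ))! * (((j : ℕ) + 1)!) ^ (b j : ℕ) : ℕ) : ℝ) := by
  have h := countPartSizes_mul_factorialWeight l (multisetOfMultiplicities fun j => (b j : ℕ))
    (by rw [sum_multisetOfMultiplicities, hb]) fun h0 => by
      obtain ⟨j, hj⟩ := mem_multisetOfMultiplicities _ h0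
      omega
  rw [factorialWeight_multisetOfMultiplicities] at h
  rw [card_multiplicity_eq, eq_div_iff]
  · exact_mod_cast h
  · exact_mod_cast (Finset.prod_pos fun j _ => by positivity).ne'

end OrderedFinpartition

/-- Faà di Bruno's formula: the `l`-th derivative of `u ∘ v` is a sum over
partitions `(b₁,…,b_l)` with `b₁ + 2b₂ + ⋯ + l·b_l = l` of
`l!/(b₁! b₂! 2!^{b₂} ⋯ b_l! l!^{b_l})` times the `L`-th Fréchet derivative of `u`
at `v t` (with `L = b₁ + ⋯ + b_l`) applied to `b_j` copies of `v^{(j)}(t)`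
for each `j = 1, …, l`. -/
theorem faa_di_bruno (p q l : ℕ)
    (u : (Fin p → ℝ) → (Fin q → ℝ)) (v : ℝ → (Fin p → ℝ))
    (hu : ContDiff ℝ l u) (hv : ContDiff ℝ l v) (t : ℝ) :
    iteratedDeriv l (fun s => u (v s)) t =
      ∑ b : Fin l → Fin (l + 1),
        if (∑ j : Fin l, ((j : ℕ) + 1) * (b j : ℕ)) = l then
          ((l ! : ℝ) /
              ((∏ j : Fin l, ((b j : ℕ))! * (((j : ℕ) + 1)!) ^ (b j : ℕ) : ℕ) : ℝ)) •
            (iteratedFDeriv ℝ (∑ j : Fin l, (b j : ℕ)) u (v t))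
              (fun i : Fin (∑ j : Fin l, (b j : ℕ)) => iteratedDeriv
                (blockIndex l (fun j => if h : j < l then (b ⟨j, h⟩ : ℕ) else 0) (i : ℕ) + 1)
                v t)
        else 0 := by
  refine (iteratedDeriv_vcomp_eq_sum_orderedFinpartition (g := u) (f := v) hu.contDiffAt
    hv.contDiffAt le_rfl).trans ?_
  rw [← Finset.sum_fiberwise _ OrderedFinpartition.multiplicity]
  refine Finset.sum_congr rfl fun b _ => ?_
  split_ifs with hb
  · rw [← OrderedFinpartition.card_multiplicity_eq_div b hb, Nat.cast_smul_eq_nsmul]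
    refine Finset.sum_eq_card_nsmul fun c hc => ?_
    refine hu.iteratedFDeriv_apply_eq_of_map_eq c.length_le (v t)
      (fun k => iteratedDeriv k v t) ?_
    rw [map_blockIndex_univ fun j => (b j : ℕ)]
    exact (c.multiplicity_eq_iff b).1 (Finset.mem_filter.1 hc).2
  · refine Finset.sum_eq_zero fun c hc => absurd ?_ hb
    rw [← (Finset.mem_filter.1 hc).2]
    exact c.sum_mul_multiplicity
end

section
/- (Corollary of Theorem A) Assume g₀ vanishes on Z, f₁ = ⋯ = f_{k-1} = 0, and Δ_α is invertible for every α ∈ Cl(V). If there exists α* ∈ V with f_k(α*) = 0 and det(Df_k(α*)) ≠ 0, then there exists a branch of zeros z(ε) with g(z(ε),ε) = 0 and |z(ε) - z_{α*}| = O(ε). -/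
open Set
open scoped Nat

open Filter Topology

/-- If `h 0, …, h k` are successive derivatives on `[-r, r]`, the first `k` of them vanish at `0`
and the last one is bounded by `M`, then `h 0` is bounded by `M * r ^ k`. -/
theorem norm_le_mul_pow_of_hasDerivAt_chain {G : Type*} [NormedAddCommGroup G] [NormedSpace ℝ G]
    {r M : ℝ} : ∀ (k : ℕ) (h : ℕ → ℝ → G),
    (∀ i < k, ∀ s, |s| ≤ r → HasDerivAt (h i) (h (i + 1) s) s) →
    (∀ i < k, h i 0 = 0) → (∀ s, |s| ≤ r → ‖h k s‖ ≤ M) →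
    ∀ s, |s| ≤ r → ‖h 0 s‖ ≤ M * r ^ k := by
  intro k
  induction k with
  | zero => intro h _ _ hM s hs; simpa using hM s hs
  | succ k ih =>
    intro h hd h0 hM s hs
    have hr : 0 ≤ r := (abs_nonneg s).trans hs
    have key : ∀ t ∈ Icc (-r) r, ‖h 1 t‖ ≤ M * r ^ k := fun t ht =>
      ih (fun i => h (i + 1)) (fun i hi => hd (i + 1) (by omega))
        (fun i hi => h0 (i + 1) (by omega)) hM t (abs_le.2 ht)
    have hmv := (convex_Icc (-r) r).norm_image_sub_le_of_norm_hasDerivWithin_le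
      (fun t ht => (hd 0 (by omega) t (abs_le.2 ht)).hasDerivWithinAt) key
      (show (0 : ℝ) ∈ Icc (-r) r from ⟨by linarith, hr⟩) (abs_le.1 hs)
    rw [h0 0 (by omega), sub_zero, sub_zero, Real.norm_eq_abs] at hmv
    have hM0 : 0 ≤ M * r ^ k := (norm_nonneg _).trans (key s (abs_le.1 hs))
    calc ‖h 0 s‖ ≤ M * r ^ k * |s| := hmv
      _ ≤ M * r ^ k * r := by gcongr
      _ = M * r ^ (k + 1) := by ring

section PartialDerivatives

variable {E G : Type*} [NormedAddCommGroup E] [NormedSpace ℝ E]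
  [NormedAddCommGroup G] [NormedSpace ℝ G]

theorem HasFDerivAt.hasDerivAt_snd {F : E × ℝ → G} {F' : E × ℝ →L[ℝ] G} {a : E} {s : ℝ}
    (h : HasFDerivAt F F' (a, s)) : HasDerivAt (fun t => F (a, t)) (F' (0, 1)) s :=
  h.comp_hasDerivAt s ((hasDerivAt_const s a).prodMk (hasDerivAt_id s))

theorem ContDiffAt.deriv_snd {n : ℕ} {F : E × ℝ → G} {x : E × ℝ}
    (hF : ContDiffAt ℝ ((n + 1 : ℕ)) F x) :
    ContDiffAt ℝ n (fun p : E × ℝ => deriv (fun s => F (p.1, s)) p.2) x := by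
  have h1 : ContDiffAt ℝ n (fun p => fderiv ℝ F p (0, 1)) x :=
    (hF.fderiv_right (by norm_cast)).clm_apply contDiffAt_const
  refine h1.congr_of_eventuallyEq ?_
  filter_upwards [hF.eventually (by simp)] with p hp
  exact (hp.differentiableAt (by simp)).hasFDerivAt.hasDerivAt_snd.deriv

theorem ContDiffAt.iteratedDeriv_snd {F : E × ℝ → G} {x : E × ℝ} (i : ℕ) :
    ∀ {n : ℕ}, ContDiffAt ℝ ((n + i : ℕ)) F x →
    ContDiffAt ℝ n (fun p : E × ℝ => iteratedDeriv i (fun s => F (p.1, s)) p.2) x := by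
  induction i with
  | zero => intro n hF; simpa using hF
  | succ i ih =>
    intro n hF
    simp only [iteratedDeriv_succ]
    have h := ih (n := n + 1) (by convert hF using 2; omega)
    exact h.deriv_snd

/-- A simple zero of the first nonvanishing coefficient of `F (a, ·)` at `0` persists as a zero of
`F (·, ε)` at distance `O(ε)`. -/
theorem exists_zero_near_of_simple_zero_iteratedDeriv [CompleteSpace E] [CompleteSpace G] (k : ℕ)
    {F : E × ℝ → G} {a₀ : E}
    (hF : ContDiffAt ℝ ((k + 1 : ℕ)) F (a₀, 0))
    (hvan : ∀ i < k, ∀ᶠ a in 𝓝 a₀, iteratedDeriv i (fun s => F (a, s)) 0 = 0)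
    (hk : iteratedDeriv k (fun s => F (a₀, s)) 0 = 0)
    (hsurj : Function.Surjective
      (fderiv ℝ (fun a => iteratedDeriv k (fun s => F (a, s)) 0) a₀)) :
    ∃ δ > (0 : ℝ), ∃ C > (0 : ℝ), ∀ ε : ℝ, ε ≠ 0 → |ε| ≤ δ →
      ∃ a, F (a, ε) = 0 ∧ ‖a - a₀‖ ≤ C * |ε| := by
  set P : ℕ → E × ℝ → G := fun i p => iteratedDeriv i (fun s => F (p.1, s)) p.2 with hP
  have hPC : ∀ i ≤ k, ContDiffAt ℝ 1 (P i) (a₀, 0) := fun i hi =>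
    ContDiffAt.iteratedDeriv_snd (n := 1) i (hF.of_le (by norm_cast; omega))
  have hstrict : HasStrictFDerivAt (P k) (fderiv ℝ (P k) (a₀, 0)) (a₀, 0) :=
    (hPC k le_rfl).hasStrictFDerivAt (by simp)
  set P' := fderiv ℝ (P k) (a₀, 0)
  set L : E →L[ℝ] G := P'.comp (ContinuousLinearMap.inl ℝ E ℝ)
  have hL : fderiv ℝ (fun a => iteratedDeriv k (fun s => F (a, s)) 0) a₀ = L :=
    (HasFDerivAt.comp (g := P k) (f := fun a => (a, (0 : ℝ))) a₀ hstrict.hasFDerivAt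
      (hasFDerivAt_prodMk_left a₀ 0)).fderiv
  rw [hL] at hsurj
  have hrange : L.range = ⊤ := LinearMap.range_eq_top.2 hsurj
  set R := L.nonlinearRightInverseOfSurjective hrange
  have hN : 0 < R.nnnorm := L.nonlinearRightInverseOfSurjective_nnnorm_pos hrange
  set N := R.nnnorm
  have hNr : (0 : ℝ) < N := hN
  have hfac : (0 : ℝ) < k ! := by exact_mod_cast k.factorial_pos
  set c : ℝ := (k ! : ℝ)⁻¹ * ((N : ℝ)⁻¹ / 2) with hc
  have hcpos : 0 < c := by positivity
  have hder : ∀ᶠ p in 𝓝 (a₀, (0 : ℝ)), ∀ i ∈ Finset.range k,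
      HasDerivAt (fun s => P i (p.1, s)) (P (i + 1) p) p.2 := by
    rw [eventually_all_finset]
    intro i hi
    filter_upwards [(hPC i (Finset.mem_range.1 hi).le).eventually (by simp)] with p hp
    have := (hp.differentiableAt (by simp)).hasFDerivAt.hasDerivAt_snd.differentiableAt.hasDerivAt
    simpa only [hP, iteratedDeriv_succ] using this
  have hvan' : ∀ᶠ a in 𝓝 a₀, ∀ i ∈ Finset.range k, P i (a, 0) = 0 := by
    rw [eventually_all_finset]
    exact fun i hi => hvan i (Finset.mem_range.1 hi)
  have hlin : ∀ᶠ q in 𝓝 ((a₀, (0 : ℝ)), (a₀, (0 : ℝ))),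
      ‖P k q.1 - P k q.2 - P' (q.1 - q.2)‖ ≤ c * ‖q.1 - q.2‖ := hstrict.isLittleO.def hcpos
  rw [nhds_prod_eq, eventually_prod_self_iff'] at hlin
  obtain ⟨t, ht, hlin⟩ := hlin
  obtain ⟨d₁, hd₁, hball₁⟩ := Metric.mem_nhds_iff.1 (inter_mem ht hder)
  obtain ⟨d₂, hd₂, hball₂⟩ := Metric.mem_nhds_iff.1 hvan'
  obtain ⟨d, hd, hdd₁, hdd₂⟩ : ∃ d > 0, d < d₁ ∧ d < d₂ :=
    ⟨min d₁ d₂ / 2, by positivity, by linarith [min_le_left d₁ d₂, lt_min hd₁ hd₂],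
      by linarith [min_le_right d₁ d₂, lt_min hd₁ hd₂]⟩
  have hmem : ∀ a ∈ Metric.closedBall a₀ d, ∀ s : ℝ, |s| ≤ d →
      (a, s) ∈ t ∧ ∀ i ∈ Finset.range k, HasDerivAt (fun s => P i (a, s)) (P (i + 1) (a, s)) s := by
    intro a ha s hs
    refine hball₁ ?_
    rw [Metric.mem_ball, Prod.dist_eq, max_lt_iff]
    exact ⟨lt_of_le_of_lt ha hdd₁, by simpa using lt_of_le_of_lt hs hdd₁⟩
  have hzero : ∀ a ∈ Metric.closedBall a₀ d, ∀ i < k, P i (a, 0) = 0 := fun a ha i hi =>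
    hball₂ (lt_of_le_of_lt ha hdd₂) i (Finset.mem_range.2 hi)
  have ha₀ : a₀ ∈ Metric.closedBall a₀ d := Metric.mem_closedBall_self hd.le
  set K := ‖P'‖ + c
  have hK : 0 < K := by positivity
  set C := 2 * N * (k ! * K) with hC
  have hCpos : 0 < C := by positivity
  refine ⟨min d (d / C), by positivity, C, hCpos, fun ε hε hεd => ?_⟩
  have hεd1 : |ε| ≤ d := hεd.trans (min_le_left _ _)
  have hεd2 : C * |ε| ≤ d := by
    rw [mul_comm, ← le_div_iff₀ hCpos]; exact hεd.trans (min_le_right _ _)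
  have hεpos : 0 < |ε| := abs_pos.2 hε
  set Φ : E → G := fun a => ((k ! : ℝ) * (ε ^ k)⁻¹) • F (a, ε) with hΦ
  have hP0 : ∀ p, P 0 p = F p := fun p => by simp [hP]
  have hcoef : ‖(k ! : ℝ) * (ε ^ k)⁻¹‖ = k ! * (|ε| ^ k)⁻¹ := by
    simp
  have happrox : ApproximatesLinearOn Φ L (Metric.closedBall a₀ d) (N⁻¹ / 2) := by
    intro a ha b hb
    have hbound := norm_le_mul_pow_of_hasDerivAt_chain (r := |ε|) (M := c * ‖a - b‖) k
      (fun i s => P i (a, s) - P i (b, s) - (s ^ (k - i) / (k - i)! : ℝ) • L (a - b))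
      (fun i hi s hs => ?_) (fun i hi => ?_) (fun s hs => ?_) ε le_rfl
    · simp only [hP0, Nat.sub_zero] at hbound
      have heq : Φ a - Φ b - L (a - b) = ((k ! : ℝ) * (ε ^ k)⁻¹) •
          (F (a, ε) - F (b, ε) - (ε ^ k / k ! : ℝ) • L (a - b)) := by
        have h1 : (k ! : ℝ) * (ε ^ k)⁻¹ * (ε ^ k / k !) = 1 := by field_simp
        simp only [hΦ, smul_sub, smul_smul, h1, one_smul]
      rw [heq, norm_smul, hcoef]
      calc k ! * (|ε| ^ k)⁻¹ * _ ≤ k ! * (|ε| ^ k)⁻¹ * (c * ‖a - b‖ * |ε| ^ k) := by gcongr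
        _ = ((N⁻¹ / 2 : NNReal) : ℝ) * ‖a - b‖ := by
          rw [hc]; push_cast; field_simp
    · have hs' := hs.trans hεd1
      have hi' := Finset.mem_range.2 hi
      refine (((hmem a ha s hs').2 i hi').sub ((hmem b hb s hs').2 i hi')).sub ?_
      refine HasDerivAt.smul_const ?_ _
      obtain ⟨j, hj⟩ : ∃ j, k - i = j + 1 := ⟨k - i - 1, by omega⟩
      rw [show k - (i + 1) = j by omega, hj]
      refine ((hasDerivAt_pow (j + 1) s).div_const _).congr_deriv ?_
      rw [Nat.factorial_succ]
      push_cast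
      have : (j ! : ℝ) ≠ 0 := by exact_mod_cast j.factorial_ne_zero
      field_simp
    · have : k - i ≠ 0 := by omega
      simp [hzero a ha i hi, hzero b hb i hi, this]
    · have hs' := hs.trans hεd1
      have := hlin (a, s) (hmem a ha s hs').1 (b, s) (hmem b hb s hs').1
      simpa [L, Prod.norm_def] using this
  have hbase : ‖Φ a₀‖ ≤ k ! * (K * |ε|) := by
    have hbound := norm_le_mul_pow_of_hasDerivAt_chain (r := |ε|) (M := K * |ε|) k
      (fun i s => P i (a₀, s))
      (fun i hi s hs => (hmem a₀ ha₀ s (hs.trans hεd1)).2 i (Finset.mem_range.2 hi))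
      (fun i hi => hzero a₀ ha₀ i hi) (fun s hs => ?_) ε le_rfl
    · simp only [hP0] at hbound
      simp only [hΦ]
      rw [norm_smul, hcoef]
      calc k ! * (|ε| ^ k)⁻¹ * _ ≤ k ! * (|ε| ^ k)⁻¹ * (K * |ε| * |ε| ^ k) := by gcongr
        _ = k ! * (K * |ε|) := by field_simp
    · have h1 := hlin (a₀, s) (hmem a₀ ha₀ s (hs.trans hεd1)).1 (a₀, 0)
        (hmem a₀ ha₀ 0 (by simpa using hd.le)).1
      have h0 : P k (a₀, 0) = 0 := hk
      have hn : ‖((a₀, s) : E × ℝ) - (a₀, 0)‖ = |s| := by simp [Prod.norm_def]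
      rw [h0, sub_zero, hn] at h1
      have h2 := P'.le_opNorm (((a₀, s) : E × ℝ) - (a₀, 0))
      rw [hn] at h2
      have h3 := norm_le_norm_sub_add (P k (a₀, s)) (P' (((a₀, s) : E × ℝ) - (a₀, 0)))
      calc ‖P k (a₀, s)‖ ≤ K * |s| := by simp only [K]; linarith
        _ ≤ K * |ε| := by gcongr
  have hsub := happrox.surjOn_closedBall_of_nonlinearRightInverse R (b := a₀) (ε := C * |ε|)
    (by positivity) (Metric.closedBall_subset_closedBall hεd2)
  obtain ⟨a, ha, hΦa⟩ := hsub (show (0 : G) ∈ _ by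
    rw [mem_closedBall_iff_norm, zero_sub, norm_neg]
    refine hbase.trans (le_of_eq ?_)
    change _ = ((N : ℝ)⁻¹ - ((N⁻¹ / 2 : NNReal) : ℝ)) * (C * |ε|)
    rw [hC]
    push_cast
    field_simp
    ring)
  refine ⟨a, ?_, by simpa [dist_eq_norm] using ha⟩
  exact (smul_eq_zero.1 hΦa).resolve_left
    (mul_ne_zero hfac.ne' (inv_ne_zero (pow_ne_zero k hε)))

end PartialDerivatives

/-- Corollary of Theorem A: if `f₁ = ⋯ = f_{k-1} = 0`, `Δ_α` is invertible on
`Cl(V)`, and `f_k` has a simple zero `α*` (i.e. `f_k(α*) = 0` with `Df_k(α*)`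
invertible), then there is a branch of zeros `z(ε)` of `g(·,ε)` with
`|z(ε) - z_{α*}| = O(ε)`. -/
theorem corollary_of_theoremA
    (m p k : ℕ) (hp : 0 < p) (hk : 1 ≤ k)
    (D : Set ((Fin m → ℝ) × (Fin p → ℝ))) (hD : IsOpen D) (hDb : Bornology.IsBounded D)
    (V : Set (Fin m → ℝ)) (hV : IsOpen V) (hVb : Bornology.IsBounded V)
    (β : (Fin m → ℝ) → (Fin p → ℝ)) (hβ : ContDiffOn ℝ (k + 1) β (closure V))
    (hZD : ∀ α ∈ closure V, ((α, β α) : (Fin m → ℝ) × (Fin p → ℝ)) ∈ D)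
    (g : ((Fin m → ℝ) × (Fin p → ℝ)) × ℝ → (Fin m → ℝ) × (Fin p → ℝ))
    (hg : ContDiffOn ℝ (k + 1) g (D ×ˢ (Set.univ : Set ℝ)))
    (hg0 : ∀ α ∈ closure V, g ((α, β α), 0) = 0)
    (hΔ : ∀ α ∈ closure V,
      Function.Bijective (fderiv ℝ (fun b => (g ((α, b), 0)).2) (β α)))
    (ε₁ : ℝ) (hε₁ : 0 < ε₁) (U : Set (Fin m → ℝ)) (hU : IsOpen U) (hVU : closure V ⊆ U)
    (βbar : (Fin m → ℝ) → ℝ → (Fin p → ℝ))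
    (hbarC : ContDiffOn ℝ (k + 1) (fun q : (Fin m → ℝ) × ℝ => βbar q.1 q.2)
      (U ×ˢ Set.Ioo (-ε₁) ε₁))
    (hbar : ∀ a ∈ U, ∀ ε ∈ Set.Ioo (-ε₁) ε₁, (g ((a, βbar a ε), ε)).2 = 0)
    (hbar0 : ∀ α ∈ closure V, βbar α 0 = β α)
    (f : ℕ → (Fin m → ℝ) → (Fin m → ℝ))
    (hfdef : ∀ i, ∀ α ∈ closure V,
      f i α = ((i ! : ℝ))⁻¹ • iteratedDeriv i (fun ε => (g ((α, βbar α ε), ε)).1) 0)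
    (hfvanish : ∀ i, 1 ≤ i → i < k → ∀ α ∈ closure V, f i α = 0)
    (αstar : Fin m → ℝ) (hαstar : αstar ∈ V)
    (hfk : f k αstar = 0)
    (hDfk : Function.Bijective (fderiv ℝ (f k) αstar)) :
    ∃ ε₂ > (0:ℝ), ∃ C > (0:ℝ), ∃ zfun : ℝ → (Fin m → ℝ) × (Fin p → ℝ),
      ∀ ε : ℝ, ε ≠ 0 → |ε| ≤ ε₂ →
        g (zfun ε, ε) = 0 ∧ ‖zfun ε - (αstar, β αstar)‖ ≤ C * |ε| := by
  have hVcl : αstar ∈ closure V := subset_closure hαstar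
  have hVnhds : V ∈ 𝓝 αstar := hV.mem_nhds hαstar
  have hβC : ContDiffAt ℝ (k + 1) (fun q : (Fin m → ℝ) × ℝ => βbar q.1 q.2) (αstar, 0) :=
    hbarC.contDiffAt (prod_mem_nhds (hU.mem_nhds (hVU hVcl))
      (Ioo_mem_nhds (by linarith) hε₁))
  set Ψ : (Fin m → ℝ) × ℝ → ((Fin m → ℝ) × (Fin p → ℝ)) × ℝ :=
    fun q => ((q.1, βbar q.1 q.2), q.2)
  have hΨ : ContDiffAt ℝ (k + 1) Ψ (αstar, 0) :=
    (contDiffAt_fst.prodMk hβC).prodMk contDiffAt_snd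
  have hgC : ContDiffAt ℝ (k + 1) g (Ψ (αstar, 0)) := by
    refine hg.contDiffAt (prod_mem_nhds (hD.mem_nhds ?_) univ_mem)
    simpa only [Ψ, hbar0 αstar hVcl] using hZD αstar hVcl
  have hF : ContDiffAt ℝ ((k + 1 : ℕ)) (fun q => (g (Ψ q)).1) (αstar, 0) :=
    contDiffAt_fst.comp _ (hgC.comp _ hΨ)
  have hder : ∀ i, ∀ α ∈ closure V,
      iteratedDeriv i (fun s => (g (Ψ (α, s))).1) 0 = (i ! : ℝ) • f i α := fun i α hα => by
    have : (i ! : ℝ) ≠ 0 := by exact_mod_cast i.factorial_ne_zero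
    rw [hfdef i α hα, smul_inv_smul₀ this]
  have hfac : (k ! : ℝ) ≠ 0 := by exact_mod_cast k.factorial_ne_zero
  obtain ⟨δ, hδ, C, hC, hzero⟩ := exists_zero_near_of_simple_zero_iteratedDeriv k hF
    (fun i hi => by
      filter_upwards [hVnhds] with α hα
      have hα' := subset_closure hα
      rcases Nat.eq_zero_or_pos i with rfl | hi0
      · simp [Ψ, hbar0 α hα', hg0 α hα']
      · rw [hder i α hα', hfvanish i hi0 hi α hα', smul_zero])
    (by rw [hder k αstar hVcl, hfk, smul_zero])
    (by
      have heq : (fun α => iteratedDeriv k (fun s => (g (Ψ (α, s))).1) 0) =ᶠ[𝓝 αstar]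
          (k ! : ℝ) • f k := by
        filter_upwards [hVnhds] with α hα
        exact hder k α (subset_closure hα)
      rw [heq.fderiv_eq, fderiv_const_smul_field]
      intro y
      obtain ⟨x, hx⟩ := hDfk.2 ((k ! : ℝ)⁻¹ • y)
      exact ⟨x, by simp [hx, smul_inv_smul₀ hfac]⟩)
  obtain ⟨K, s, hs, hLip⟩ := (hβC.of_le (m := 1) (by simp)).exists_lipschitzOnWith
  obtain ⟨d, hd, hball⟩ := Metric.mem_nhds_iff.1
    (inter_mem hs (prod_mem_nhds (hU.mem_nhds (hVU hVcl)) (Ioo_mem_nhds (neg_lt_zero.2 hε₁) hε₁)))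
  choose! a ha using hzero
  have hC1 : 0 < C + 1 := by linarith
  refine ⟨min δ (d / (2 * (C + 1))), by positivity, (K + 1) * (C + 1), by positivity,
    fun ε => (a ε, βbar (a ε) ε), fun ε hε hεle => ?_⟩
  obtain ⟨hFa, hdist⟩ := ha ε hε (hεle.trans (min_le_left _ _))
  have hε2 : (C + 1) * |ε| ≤ d / 2 := by
    have := hεle.trans (min_le_right _ _)
    rw [le_div_iff₀ (by positivity)] at this
    linarith
  have hnorm : ‖((a ε, ε) : (Fin m → ℝ) × ℝ) - (αstar, 0)‖ ≤ (C + 1) * |ε| := by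
    have h0 := abs_nonneg ε
    refine max_le (hdist.trans (by gcongr; linarith)) ?_
    simp only [Prod.snd_sub, sub_zero, Real.norm_eq_abs]
    nlinarith
  obtain ⟨hmem, hmemU, hmemε⟩ := hball (show ((a ε, ε) : (Fin m → ℝ) × ℝ) ∈ _ by
    rw [mem_ball_iff_norm]; linarith)
  refine ⟨Prod.ext hFa (hbar _ hmemU _ hmemε), max_le ?_ ?_⟩
  · calc ‖a ε - αstar‖ ≤ (C + 1) * |ε| := (norm_fst_le _).trans hnorm
      _ ≤ (K + 1) * (C + 1) * |ε| := by
        rw [mul_assoc]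
        exact le_mul_of_one_le_left (by positivity) (by simp)
  · have h := hLip.norm_sub_le hmem (mem_of_mem_nhds hs)
    simp only [hbar0 αstar hVcl] at h
    calc ‖βbar (a ε) ε - β αstar‖ ≤ K * ((C + 1) * |ε|) := h.trans (by gcongr)
      _ ≤ (K + 1) * (C + 1) * |ε| := by
        rw [mul_assoc]
        gcongr
        simp
end
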